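/- arXiv:math/9411239 — 2 statements merged into one kernel-verified Lean document; each statement's English description precedes it below -/
import Mathlib

section
/- For all natural numbers a, c, the number N_τ(a,a,c) of symmetric plane partitions in the a×a×c box satisfies N_τ(a,a,c) · ∏_{i=1}^{a} (2i−1) · ∏_{1 ≤ i < j ≤ a} (i+j−1) = ∏_{i=1}^{a} (c+2i−1) · ∏_{1 ≤ i < j ≤ a} (c+i+j−1). -/
open Finset

/-- A plane partition in an `a × b × c` box: a lower set of `Fin a × Fin b × Fin c`
for the componentwise order. -/
def IsPP (a b c : ℕ) (T : Finset (Fin a × Fin b × Fin c)) : Prop :=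
  ∀ p ∈ T, ∀ q : Fin a × Fin b × Fin c,
    q.1 ≤ p.1 → q.2.1 ≤ p.2.1 → q.2.2 ≤ p.2.2 → q ∈ T

set_option synthInstance.maxSize 400 in
instance (a b c : ℕ) : DecidablePred (IsPP a b c) := fun _ => by
  unfold IsPP; infer_instance

/-- Transposition of plane partitions in an `a × a × c` box:
`τ(T) = {(j,i,k) : (i,j,k) ∈ T}`. -/
def ppTau (a c : ℕ) (T : Finset (Fin a × Fin a × Fin c)) :
    Finset (Fin a × Fin a × Fin c) :=
  T.image fun p => (p.2.1, p.1, p.2.2)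

open Classical in
/-- Weakly increasing sequences of length `a` with entries below `n`. -/
noncomputable def monoSeqs (a n : ℕ) : Finset (Fin a → ℕ) :=
  (Fintype.piFinset fun _ => range n).filter Monotone

lemma mem_monoSeqs {a n : ℕ} {l : Fin a → ℕ} :
    l ∈ monoSeqs a n ↔ (∀ i, l i < n) ∧ Monotone l := by
  simp [monoSeqs, Fintype.mem_piFinset]

lemma Fin.monotone_snoc_nat {a n : ℕ} {l : Fin a → ℕ} (hl : Monotone l) (hn : ∀ i, l i ≤ n) :
    Monotone (Fin.snoc l n : Fin (a + 1) → ℕ) := by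
  intro i j hij
  induction j using Fin.lastCases with
  | last =>
    induction i using Fin.lastCases with
    | last => simp
    | cast i => simpa using hn i
  | cast j =>
    induction i using Fin.lastCases with
    | last => exact absurd hij (by simp)
    | cast i => simpa using hl (Fin.castSucc_le_castSucc_iff.1 hij)

lemma Fin.monotone_cons_zero {a : ℕ} {l : Fin a → ℕ} (hl : Monotone l) :
    Monotone (Fin.cons 0 l : Fin (a + 1) → ℕ) := by
  intro i j hij
  induction i using Fin.cases with
  | zero => simp
  | succ i =>
    induction j using Fin.cases with
    | zero => exact absurd hij (by simp)
    | succ j => simpa using hl (Fin.succ_le_succ_iff.1 hij)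

/-- Splitting weakly increasing sequences according to whether the last entry is maximal. -/
lemma sum_monoSeqs_snoc {M : Type*} [AddCommMonoid M] (a n : ℕ) (F : (Fin (a + 1) → ℕ) → M) :
    ∑ l ∈ monoSeqs (a + 1) (n + 1), F l =
      ∑ l ∈ monoSeqs (a + 1) n, F l +
        ∑ l ∈ monoSeqs a (n + 1), F (Fin.snoc (α := fun _ => ℕ) l n) := by
  rw [← sum_filter_add_sum_filter_not (monoSeqs (a + 1) (n + 1)) (fun l => l (Fin.last a) < n)]
  congr 1
  · refine sum_congr ?_ fun _ _ => rfl
    ext l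
    simp only [mem_filter, mem_monoSeqs]
    constructor
    · rintro ⟨⟨-, h⟩, h'⟩
      exact ⟨fun i => (h (Fin.le_last i)).trans_lt h', h⟩
    · rintro ⟨h, h'⟩
      exact ⟨⟨fun i => (h i).trans (by omega), h'⟩, h _⟩
  · refine sum_nbij' (fun l => Fin.init l) (fun l => Fin.snoc (α := fun _ => ℕ) l n) ?_ ?_ ?_ ?_ ?_
    · simp only [mem_filter, mem_monoSeqs]
      rintro l ⟨⟨h, h'⟩, -⟩
      exact ⟨fun i => h _, fun i j hij => h' (Fin.castSucc_le_castSucc_iff.2 hij)⟩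
    · simp only [mem_filter, mem_monoSeqs]
      rintro l ⟨h, h'⟩
      refine ⟨⟨fun i => ?_, Fin.monotone_snoc_nat h' fun i => Nat.le_of_lt_succ (h i)⟩, by simp⟩
      induction i using Fin.lastCases with
      | last => simp
      | cast i => simpa using h i
    · simp only [mem_filter, mem_monoSeqs]
      rintro l ⟨⟨h, -⟩, h'⟩
      have : n = l (Fin.last a) := by have := h (Fin.last a); omega
      rw [this, Fin.snoc_init_self]
    · intro l _
      simp
    · simp only [mem_filter, mem_monoSeqs]
      rintro l ⟨⟨h, -⟩, h'⟩
      have : n = l (Fin.last a) := by have := h (Fin.last a); omega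
      rw [this, Fin.snoc_init_self]

/-- Splitting weakly increasing sequences according to whether the first entry is zero. -/
lemma sum_monoSeqs_cons {M : Type*} [AddCommMonoid M] (a n : ℕ) (F : (Fin (a + 1) → ℕ) → M) :
    ∑ l ∈ monoSeqs (a + 1) (n + 1), F l =
      ∑ l ∈ monoSeqs (a + 1) n, F (fun i => l i + 1) +
        ∑ l ∈ monoSeqs a (n + 1), F (Fin.cons (α := fun _ => ℕ) 0 l) := by
  rw [← sum_filter_add_sum_filter_not (monoSeqs (a + 1) (n + 1)) (fun l => l 0 ≠ 0)]
  congr 1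
  · refine sum_nbij' (fun l i => l i - 1) (fun l i => l i + 1) ?_ ?_ ?_ ?_ ?_
    · simp only [mem_filter, mem_monoSeqs]
      rintro l ⟨⟨h, h'⟩, h0⟩
      refine ⟨fun i => ?_, fun i j hij => Nat.sub_le_sub_right (h' hij) 1⟩
      have := h i
      have := h' (Fin.zero_le i)
      omega
    · simp only [mem_filter, mem_monoSeqs]
      rintro l ⟨h, h'⟩
      exact ⟨⟨fun i => Nat.succ_lt_succ (h i), fun i j hij => Nat.succ_le_succ (h' hij)⟩,
        Nat.succ_ne_zero _⟩
    · simp only [mem_filter, mem_monoSeqs]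
      rintro l ⟨⟨h, h'⟩, h0⟩
      funext i
      have := h' (Fin.zero_le i)
      show l i - 1 + 1 = l i
      omega
    · intro l _
      simp
    · simp only [mem_filter, mem_monoSeqs]
      rintro l ⟨⟨h, h'⟩, h0⟩
      congr 1
      funext i
      have := h' (Fin.zero_le i)
      show l i = l i - 1 + 1
      omega
  · refine sum_nbij' (fun l => Fin.tail l) (fun l => Fin.cons (α := fun _ => ℕ) 0 l) ?_ ?_ ?_ ?_ ?_
    · simp only [mem_filter, mem_monoSeqs]
      rintro l ⟨⟨h, h'⟩, -⟩
      exact ⟨fun i => h _, fun i j hij => h' (Fin.succ_le_succ_iff.2 hij)⟩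
    · simp only [mem_filter, mem_monoSeqs]
      rintro l ⟨h, h'⟩
      refine ⟨⟨fun i => ?_, Fin.monotone_cons_zero h'⟩, by simp⟩
      induction i using Fin.cases with
      | zero => simp
      | succ i => simpa using h i
    · simp only [mem_filter, mem_monoSeqs, not_not]
      rintro l ⟨-, h'⟩
      rw [← h', Fin.cons_self_tail]
    · intro l _
      simp
    · simp only [mem_filter, mem_monoSeqs, not_not]
      rintro l ⟨-, h'⟩
      rw [← h', Fin.cons_self_tail]

/-- The sum of the alternants `det (x i ^ (l j + j))` over weakly increasing `l` with entries
below `n`. -/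
noncomputable def alternantSum {a : ℕ} (n : ℕ) (x : Fin a → ℝ) : ℝ :=
  ∑ l ∈ monoSeqs a n, (Matrix.of fun i j => x i ^ (l j + j)).det

lemma alternantSum_succ_last {a : ℕ} (n : ℕ) (x : Fin (a + 1) → ℝ) :
    alternantSum (n + 1) x = alternantSum n x +
      ∑ i : Fin (a + 1), (-1) ^ (i + a : ℕ) * x i ^ (n + a) *
        alternantSum (n + 1) (fun k => x (i.succAbove k)) := by
  unfold alternantSum
  rw [sum_monoSeqs_snoc]
  congr 1
  simp_rw [mul_sum]
  rw [sum_comm]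
  refine sum_congr rfl fun l _ => ?_
  rw [Matrix.det_succ_column _ (Fin.last a)]
  refine sum_congr rfl fun i _ => ?_
  congr 1
  · simp
  · congr 1
    ext k j
    simp

lemma alternantSum_succ_zero {a : ℕ} (n : ℕ) (x : Fin (a + 1) → ℝ) :
    alternantSum (n + 1) x = (∏ i, x i) * alternantSum n x +
      ∑ i : Fin (a + 1), (-1) ^ (i : ℕ) * (∏ k, x (i.succAbove k)) *
        alternantSum (n + 1) (fun k => x (i.succAbove k)) := by
  unfold alternantSum
  rw [sum_monoSeqs_cons]
  congr 1
  · rw [mul_sum]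
    refine sum_congr rfl fun l _ => ?_
    rw [← Matrix.det_mul_column]
    congr 1
    ext i j
    simp only [Matrix.of_apply]
    ring
  simp_rw [mul_sum]
  rw [sum_comm]
  refine sum_congr rfl fun l _ => ?_
  rw [Matrix.det_succ_column_zero]
  refine sum_congr rfl fun i _ => ?_
  rw [mul_assoc _ (∏ k, x (i.succAbove k)), ← Matrix.det_mul_column]
  congr 1
  · simp
  · congr 1
    ext k j
    simp only [Matrix.submatrix_apply, Matrix.of_apply, Fin.cons_succ, Fin.val_succ]
    ring

lemma alternantSum_recursion {a : ℕ} (n : ℕ) (x : Fin (a + 1) → ℝ) :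
    (1 - ∏ i, x i) * alternantSum (n + 1) x =
      ∑ i : Fin (a + 1), (-1) ^ (i : ℕ) * (1 - (-1) ^ a * x i ^ (n + a + 1)) *
        (∏ k, x (i.succAbove k)) * alternantSum (n + 1) (fun k => x (i.succAbove k)) := by
  have h1 := alternantSum_succ_last n x
  have h2 := alternantSum_succ_zero n x
  have h3 : ∑ i : Fin (a + 1), (-1) ^ (i : ℕ) * (1 - (-1) ^ a * x i ^ (n + a + 1)) *
        (∏ k, x (i.succAbove k)) * alternantSum (n + 1) (fun k => x (i.succAbove k)) =
      ∑ i : Fin (a + 1), (-1) ^ (i : ℕ) * (∏ k, x (i.succAbove k)) *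
        alternantSum (n + 1) (fun k => x (i.succAbove k)) -
      (∏ i, x i) * ∑ i : Fin (a + 1), (-1) ^ (i + a : ℕ) * x i ^ (n + a) *
        alternantSum (n + 1) (fun k => x (i.succAbove k)) := by
    rw [mul_sum, ← sum_sub_distrib]
    refine sum_congr rfl fun i _ => ?_
    rw [Fin.prod_univ_succAbove x i]
    ring
  rw [h3]
  linear_combination h2 - (∏ i, x i) * h1

lemma prod_pairs_succAbove {M : Type*} [CommMonoid M] {a : ℕ} (f : Fin (a + 1) → Fin (a + 1) → M)
    (hf : ∀ i j, f i j = f j i) (p : Fin (a + 1)) :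
    ∏ i, ∏ j ∈ Ioi i, f i j =
      (∏ k, f p (p.succAbove k)) *
        ∏ i, ∏ j ∈ Ioi i, f (p.succAbove i) (p.succAbove j) := by
  have key : ∀ (b : ℕ) (g : Fin b → Fin b → M),
      ∏ i, ∏ j ∈ Ioi i, g i j = ∏ i, ∏ j, if i < j then g i j else 1 := by
    intro b g
    refine prod_congr rfl fun i _ => ?_
    rw [← prod_filter]
    congr 1
    ext j
    simp
  rw [key, key, Fin.prod_univ_succAbove _ p, Fin.prod_univ_succAbove _ p]
  simp_rw [fun i => Fin.prod_univ_succAbove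
    (fun j => if p.succAbove i < j then f (p.succAbove i) j else 1) p]
  rw [prod_mul_distrib, ← mul_assoc]
  simp only [lt_irrefl, if_false, one_mul, Fin.succAbove_lt_succAbove_iff]
  rw [← prod_mul_distrib]
  congr 1
  refine prod_congr rfl fun k _ => ?_
  rcases lt_or_gt_of_ne (Fin.succAbove_ne p k) with h | h
  · rw [if_neg h.not_gt, if_pos h, one_mul, hf]
  · rw [if_pos h, if_neg h.not_gt, mul_one]

/-- Coefficients of `∏ j, (z - x j * y)` as a homogeneous polynomial in `y` and `z`. -/
lemma exists_coeff_prod_sub (a : ℕ) (x : Fin a → ℝ) :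
    ∃ p : ℕ → ℝ, p 0 = 1 ∧ p a = (-1) ^ a * ∏ j, x j ∧ (∀ k, a < k → p k = 0) ∧
      ∀ y z : ℝ, ∑ k ∈ range (a + 1), p k * y ^ k * z ^ (a - k) = ∏ j, (z - x j * y) := by
  induction a with
  | zero => exact ⟨fun k => if k = 0 then 1 else 0, by simp, by simp, by
      intro k hk; simp; omega, by simp⟩
  | succ a ih =>
    obtain ⟨p, h0, ha, hz, hp⟩ := ih (fun j => x j.succ)
    refine ⟨fun k => Nat.casesOn k 1 fun k => p (k + 1) - x 0 * p k, rfl, ?_, ?_, ?_⟩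
    · show p (a + 1) - x 0 * p a = _
      rw [hz _ (Nat.lt_succ_self a), ha, Fin.prod_univ_succ]
      ring
    · intro k hk
      cases k with
      | zero => omega
      | succ k =>
        show p (k + 1) - x 0 * p k = 0
        rw [hz _ (by omega), hz _ (by omega)]
        ring
    · intro y z
      rw [Fin.prod_univ_succ, ← hp, sub_mul, sum_range_succ']
      have e1 : z * ∑ k ∈ range (a + 1), p k * y ^ k * z ^ (a - k) =
          ∑ k ∈ range (a + 1), p (k + 1) * y ^ (k + 1) * z ^ (a - k) + z ^ (a + 1) := by
        have : z * ∑ k ∈ range (a + 1), p k * y ^ k * z ^ (a - k) =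
            ∑ k ∈ range (a + 2), p k * y ^ k * z ^ (a + 1 - k) := by
          rw [sum_range_succ _ (a + 1), hz _ (Nat.lt_succ_self a), mul_sum]
          simp only [zero_mul, add_zero]
          refine sum_congr rfl fun k hk => ?_
          rw [Nat.succ_sub (by simpa [Nat.lt_succ_iff] using hk), pow_succ]
          ring
        rw [this, sum_range_succ', h0]
        simp
      rw [e1, mul_sum]
      simp only [Nat.add_sub_add_right, pow_zero, mul_one, Nat.sub_zero]
      rw [add_sub_right_comm, ← sum_sub_distrib]
      congr 1
      · refine sum_congr rfl fun k _ => ?_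
        ring
      · exact one_mul _

/-- A combination of `f 0, …, f (a + 1)` whose coefficients have vanishing alternating sum is a
combination of the sums of neighbours. -/
lemma exists_sum_neighbours (a : ℕ) (q : ℕ → ℝ)
    (hq : ∑ k ∈ range (a + 2), (-1) ^ k * q k = 0) :
    ∃ b : ℕ → ℝ, b 0 = q 0 ∧ ∀ f : ℕ → ℝ,
      ∑ k ∈ range (a + 1), b k * (f k + f (k + 1)) = ∑ k ∈ range (a + 2), q k * f k := by
  let b : ℕ → ℝ := fun k => Nat.rec (q 0) (fun k bk => q (k + 1) - bk) k
  have hb : ∀ k, b (k + 1) = q (k + 1) - b k := fun _ => rfl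
  have h1 : ∀ m, ∑ k ∈ range (m + 1), (-1) ^ k * q k = (-1) ^ m * b m := by
    intro m
    induction m with
    | zero => simp [b]
    | succ m ih => rw [sum_range_succ, ih, hb]; ring
  have h2 : ∀ (f : ℕ → ℝ) (m : ℕ), ∑ k ∈ range (m + 1), b k * (f k + f (k + 1)) =
      ∑ k ∈ range (m + 1), q k * f k + b m * f (m + 1) := by
    intro f m
    induction m with
    | zero => simp [b]; ring
    | succ m ih => rw [sum_range_succ, ih, sum_range_succ _ (m + 1), hb]; ring
  refine ⟨b, rfl, fun f => ?_⟩
  have h3 : b (a + 1) = 0 := by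
    have := h1 (a + 1)
    rw [hq] at this
    rcases mul_eq_zero.1 this.symm with h | h
    · exact absurd h (by simp)
    · exact h
  rw [h2, sum_range_succ _ (a + 1)]
  rw [hb] at h3
  rw [sub_eq_zero.1 h3]

/-- The column replacing the first column of the type `B` alternant in its recursion is a
combination of its columns. -/
lemma exists_column_combination (a c : ℕ) (x : Fin (a + 1) → ℝ) (hx : ∀ i, 1 < x i) :
    ∃ b : Fin (a + 1) → ℝ, b 0 = 1 - ∏ i, x i ∧ ∀ i,
      (1 - (-1) ^ a * x i ^ (c + a + 1)) * ((1 - x i) * ∏ k, (1 - x i * x (i.succAbove k))) =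
        ∑ k, b k * (x i ^ (k : ℕ) - x i ^ (c + 2 * a + 1 - k)) := by
  obtain ⟨p, h0, ha, -, hp⟩ := exists_coeff_prod_sub (a + 1) x
  obtain ⟨b, hb0, hb⟩ := exists_sum_neighbours a (fun k => p k + (-1) ^ a * p (a + 1 - k)) (by
    have e := hp (-1) 1
    have e' : ∑ k ∈ range (a + 2), (-1) ^ k * ((-1) ^ a * p (a + 1 - k)) =
        - ∑ k ∈ range (a + 2), p k * (-1) ^ k * 1 ^ (a + 1 - k) := by
      rw [← sum_range_reflect, ← sum_neg_distrib]
      refine sum_congr rfl fun k hk => ?_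
      obtain ⟨m, hm⟩ := Nat.exists_eq_add_of_le (Nat.lt_succ_iff.1 (mem_range.1 hk))
      have e1 : a + 2 - 1 - k = m := by omega
      have e2 : a + 1 - m = k := by omega
      rw [e1, e2]
      have : (-1 : ℝ) ^ m * (-1) ^ a = - (-1) ^ k := by
        have h : (-1 : ℝ) ^ (k + k) = 1 := Even.neg_one_pow ⟨k, rfl⟩
        have h' : (-1 : ℝ) ^ (m + m) = 1 := Even.neg_one_pow ⟨m, rfl⟩
        have h'' : (-1 : ℝ) ^ (a + 1) = (-1) ^ k * (-1) ^ m := by rw [hm, pow_add]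
        rw [pow_succ] at h''
        rw [pow_add] at h'
        linear_combination (-(-1 : ℝ) ^ m) * h'' - (-1) ^ k * h'
      rw [one_pow]
      linear_combination p k * this
    simp only [mul_add, sum_add_distrib, e']
    simp [mul_comm])
  refine ⟨fun k => b k, ?_, fun i => ?_⟩
  · show b 0 = _
    have : ((-1 : ℝ) ^ a) * (-1) ^ a = 1 := by rw [← pow_add]; exact Even.neg_one_pow ⟨a, rfl⟩
    rw [hb0, h0, Nat.sub_zero, ha, pow_succ]
    linear_combination (- ∏ i, x i) * this
  have hxi : 1 + x i ≠ 0 := by linarith [hx i]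
  rw [Fin.sum_univ_eq_sum_range (fun k => b k * (x i ^ k - x i ^ (c + 2 * a + 1 - k)))]
  apply mul_left_cancel₀ hxi
  have e1 := hb (fun k => x i ^ k - x i ^ (c + 2 * a + 2 - k))
  have e2 : (1 + x i) * ∑ k ∈ range (a + 1), b k * (x i ^ k - x i ^ (c + 2 * a + 1 - k)) =
      ∑ k ∈ range (a + 1), b k * (x i ^ k - x i ^ (c + 2 * a + 2 - k) +
        (x i ^ (k + 1) - x i ^ (c + 2 * a + 2 - (k + 1)))) := by
    rw [mul_sum]
    refine sum_congr rfl fun k hk => ?_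
    obtain ⟨m, hm⟩ := Nat.exists_eq_add_of_le (Nat.lt_succ_iff.1 (mem_range.1 hk))
    rw [show c + 2 * a + 2 - k = (c + 2 * a + 1 - k) + 1 by omega,
      show c + 2 * a + 2 - (k + 1) = c + 2 * a + 1 - k by omega]
    ring
  rw [e2, e1]
  have hP : ∑ k ∈ range (a + 2), p k * x i ^ k =
      (1 + x i) * ((1 - x i) * ∏ k, (1 - x i * x (i.succAbove k))) := by
    have := hp (x i) 1
    simp only [one_pow, mul_one] at this
    rw [this, Fin.prod_univ_succAbove _ i]
    simp_rw [mul_comm (x (i.succAbove _)) (x i)]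
    ring
  have hP' : ∑ k ∈ range (a + 2), p k * x i ^ (a + 1 - k) = 0 := by
    have := hp 1 (x i)
    simp only [one_pow, mul_one] at this
    rw [this]
    exact prod_eq_zero (mem_univ i) (sub_self _)
  have refl : ∀ F : ℕ → ℕ → ℝ, ∑ k ∈ range (a + 2), F (a + 1 - k) k =
      ∑ k ∈ range (a + 2), F k (a + 1 - k) := by
    intro F
    rw [← sum_range_reflect]
    refine sum_congr rfl fun k hk => ?_
    have := mem_range.1 hk
    rw [show a + 1 - (a + 2 - 1 - k) = k by omega, show a + 2 - 1 - k = a + 1 - k by omega]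
  have s1 : ∑ k ∈ range (a + 2), p k * x i ^ (c + 2 * a + 2 - k) = 0 := by
    rw [← mul_zero (x i ^ (c + a + 1)), ← hP', mul_sum]
    refine sum_congr rfl fun k hk => ?_
    have := mem_range.1 hk
    rw [show c + 2 * a + 2 - k = (c + a + 1) + (a + 1 - k) by omega, pow_add]
    ring
  have s2 : ∑ k ∈ range (a + 2), p (a + 1 - k) * x i ^ k = 0 := by
    rw [refl fun m k => p m * x i ^ k, hP']
  have s3 : ∑ k ∈ range (a + 2), p (a + 1 - k) * x i ^ (c + 2 * a + 2 - k) =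
      x i ^ (c + a + 1) * ∑ k ∈ range (a + 2), p k * x i ^ k := by
    rw [refl fun m k => p m * x i ^ (c + 2 * a + 2 - k), mul_sum]
    refine sum_congr rfl fun k hk => ?_
    have := mem_range.1 hk
    rw [show c + 2 * a + 2 - (a + 1 - k) = (c + a + 1) + k by omega, pow_add]
    ring
  have s4 : ∑ k ∈ range (a + 2), (p k + (-1) ^ a * p (a + 1 - k)) *
      (x i ^ k - x i ^ (c + 2 * a + 2 - k)) =
      ∑ k ∈ range (a + 2), p k * x i ^ k - ∑ k ∈ range (a + 2), p k * x i ^ (c + 2 * a + 2 - k) +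
      (-1) ^ a * (∑ k ∈ range (a + 2), p (a + 1 - k) * x i ^ k -
        ∑ k ∈ range (a + 2), p (a + 1 - k) * x i ^ (c + 2 * a + 2 - k)) := by
    rw [← sum_sub_distrib, ← sum_sub_distrib, mul_sum, ← sum_add_distrib]
    refine sum_congr rfl fun k _ => ?_
    ring
  rw [s4, s1, s2, s3, hP]
  ring

/-- Macdonald's bounded Littlewood identity, in terms of alternants. -/
theorem alternantSum_eq_det (c : ℕ) {a : ℕ} (x : Fin a → ℝ) (hx : ∀ i, 1 < x i) :
    (∏ i, (1 - x i)) * (∏ i, ∏ j ∈ Ioi i, (1 - x i * x j)) * alternantSum (c + 1) x =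
      (Matrix.of fun i j : Fin a => x i ^ (j : ℕ) - x i ^ (c + 2 * a - 1 - j)).det := by
  induction a with
  | zero =>
    have : monoSeqs 0 (c + 1) = univ := by
      ext l
      simpa [mem_monoSeqs, Subsingleton.monotone] using Subsingleton.elim _ _
    simp [alternantSum, this]
  | succ a ih =>
    have hX : 1 - ∏ i, x i ≠ 0 := by
      have : 1 < ∏ i, x i := by
        rw [Fin.prod_univ_succ]
        exact one_lt_mul_of_lt_of_le (hx 0)
          (Finset.one_le_prod fun i _ => (hx i.succ).le)
      linarith
    obtain ⟨b, hb0, hb⟩ := exists_column_combination a c x hx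
    set A : Matrix (Fin (a + 1)) (Fin (a + 1)) ℝ :=
      Matrix.of fun i j => x i ^ (j : ℕ) - x i ^ (c + 2 * (a + 1) - 1 - j) with hA
    have hdet := Matrix.det_updateCol_sum A 0 b
    rw [hb0, smul_eq_mul] at hdet
    apply mul_left_cancel₀ hX
    rw [← hdet, mul_left_comm, alternantSum_recursion, Matrix.det_succ_column_zero, mul_sum]
    refine sum_congr rfl fun i _ => ?_
    rw [Matrix.updateCol_self, prod_pairs_succAbove (fun i j => 1 - x i * x j)
      (fun i j => by rw [mul_comm]) i, Fin.prod_univ_succAbove (fun j => 1 - x j) i]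
    have e1 : ∑ k, b k • A i k = (1 - (-1) ^ a * x i ^ (c + a + 1)) *
        ((1 - x i) * ∏ k, (1 - x i * x (i.succAbove k))) := by
      rw [hb i]
      simp [hA, smul_eq_mul, show c + 2 * (a + 1) - 1 = c + 2 * a + 1 by omega]
    have e2 : ((A.updateCol 0 fun k => ∑ i, b i • A k i).submatrix i.succAbove Fin.succ).det =
        (∏ k, x (i.succAbove k)) * (Matrix.of fun k j : Fin a => x (i.succAbove k) ^ (j : ℕ) -
          x (i.succAbove k) ^ (c + 2 * a - 1 - j)).det := by
      rw [← Matrix.det_mul_column]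
      congr 1
      ext k j
      rw [Matrix.submatrix_apply, Matrix.updateCol_ne (Fin.succ_ne_zero j)]
      simp only [hA, Matrix.of_apply, Fin.val_succ]
      have := j.isLt
      rw [show c + 2 * (a + 1) - 1 - (j + 1 : ℕ) = (c + 2 * a - 1 - j) + 1 by omega]
      ring
    rw [e1, e2, ← ih (fun k => x (i.succAbove k)) fun k => hx _]
    ring

open Polynomial in
/-- Chebyshev-type polynomials expressing `α ^ (n + 1) - β ^ (n + 1)` through `α + β`. -/
lemma exists_monic_pow_sub_pow (y : ℝ) : ∃ U : ℕ → ℝ[X], (∀ n, (U n).natDegree = n) ∧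
    (∀ n, (U n).Monic) ∧ ∀ n α β, α * β = y →
      α ^ (n + 1) - β ^ (n + 1) = (α - β) * (U n).eval (α + β) := by
  have key : ∀ n : ℕ, ∃ p : ℝ[X] × ℝ[X], (p.1.natDegree = n ∧ p.1.Monic ∧ ∀ α β, α * β = y →
        α ^ (n + 1) - β ^ (n + 1) = (α - β) * p.1.eval (α + β)) ∧
      (p.2.natDegree = n + 1 ∧ p.2.Monic ∧ ∀ α β, α * β = y →
        α ^ (n + 2) - β ^ (n + 2) = (α - β) * p.2.eval (α + β)) := by
    intro n
    induction n with
    | zero =>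
      refine ⟨(1, X), ⟨by simp, monic_one, fun α β _ => by simp⟩, by simp, monic_X, ?_⟩
      intro α β _
      simp only [eval_X]
      ring
    | succ n ih =>
      obtain ⟨⟨p, r⟩, ⟨hp, -, hpe⟩, hr, hrm, hre⟩ := ih
      have hXr : (X * r).natDegree = n + 2 := by
        rw [monic_X.natDegree_mul hrm, hr, natDegree_X]; ring
      have hlt' : (C y * p).natDegree < (X * r).natDegree := by
        rw [hXr]
        exact (natDegree_C_mul_le y p).trans_lt (hp.trans_lt (by omega))
      have hlt : (C y * p).degree < (X * r).degree := degree_lt_degree hlt'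
      refine ⟨(r, X * r - C y * p), ⟨hr, hrm, hre⟩, ?_, ?_, ?_⟩
      · show (X * r - C y * p).natDegree = n + 1 + 1
        rw [natDegree_sub_eq_left_of_natDegree_lt hlt', hXr]
      · exact (monic_X.mul hrm).sub_of_left hlt
      · intro α β h
        have e1 := hpe α β h
        have e2 := hre α β h
        simp only [eval_sub, eval_mul, eval_X, eval_C] at e1 e2 ⊢
        rw [← h]
        linear_combination (α + β) * e2 - α * β * e1
  choose p hp using key
  exact ⟨fun n => (p n).1, fun n => (hp n).1.1, fun n => (hp n).1.2.1, fun n => (hp n).1.2.2⟩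

/-- The real `q`-analogue of a natural number. -/
noncomputable def qNat (q : ℝ) (n : ℕ) : ℝ := ∑ k ∈ range n, q ^ k

lemma pow_sub_one_eq_qNat (q : ℝ) (n : ℕ) : q ^ n - 1 = (q - 1) * qNat q n :=
  (mul_geom_sum q n).symm

lemma continuous_qNat (n : ℕ) : Continuous fun q => qNat q n := by
  unfold qNat
  fun_prop

lemma qNat_one (n : ℕ) : qNat 1 n = n := by simp [qNat]

lemma pow_sub_pow_eq_qNat (q : ℝ) {m n : ℕ} (h : m ≤ n) :
    q ^ n - q ^ m = (q - 1) * (q ^ m * qNat q (n - m)) := by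
  obtain ⟨k, rfl⟩ := Nat.exists_eq_add_of_le h
  rw [Nat.add_sub_cancel_left, pow_add]
  linear_combination q ^ m * pow_sub_one_eq_qNat q k

lemma alternant_principal {a : ℕ} (q : ℝ) {l : Fin a → ℕ} (hl : Monotone l) :
    (Matrix.of fun i j : Fin a => (q ^ ((i : ℕ) + 1)) ^ (l j + (j : ℕ))).det =
      (∏ i : Fin a, ∏ _j ∈ Ioi i, (q - 1)) * ((∏ j : Fin a, q ^ (l j + (j : ℕ))) *
        ∏ i : Fin a, ∏ j ∈ Ioi i,
          (q ^ (l i + (i : ℕ)) * qNat q ((l j + j) - (l i + i)))) := by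
  have e : (Matrix.of fun i j : Fin a => (q ^ ((i : ℕ) + 1)) ^ (l j + (j : ℕ))) =
      Matrix.of fun i j : Fin a => q ^ (l j + (j : ℕ)) *
        (Matrix.vandermonde fun j : Fin a => q ^ (l j + (j : ℕ))).transpose i j := by
    ext i j
    simp only [Matrix.of_apply, Matrix.transpose_apply, Matrix.vandermonde_apply]
    rw [← pow_succ', ← pow_mul, ← pow_mul, mul_comm]
  rw [e, Matrix.det_mul_row, Matrix.det_transpose, Matrix.det_vandermonde, mul_left_comm]
  congr 1
  rw [← prod_mul_distrib]
  refine prod_congr rfl fun i _ => ?_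
  rw [← prod_mul_distrib]
  refine prod_congr rfl fun j hj => ?_
  have hij : i < j := mem_Ioi.1 hj
  have h1 := hl hij.le
  have h2 : (i : ℕ) < j := hij
  exact pow_sub_pow_eq_qNat q (by omega)

lemma det_principal (a c : ℕ) (q : ℝ) :
    (Matrix.of fun i j : Fin a => (q ^ ((i : ℕ) + 1)) ^ (j : ℕ) -
        (q ^ ((i : ℕ) + 1)) ^ (c + 2 * a - 1 - j)).det =
      ((∏ _i : Fin a, (-(q - 1))) * ∏ i : Fin a, ∏ _j ∈ Ioi i, (-(q - 1) * (q - 1))) *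
      ((∏ j : Fin a, q ^ (j : ℕ) * qNat q (c + 2 * a - 1 - 2 * j)) *
        ∏ i : Fin a, ∏ j ∈ Ioi i,
          (q ^ (i : ℕ) * qNat q (j - i) * qNat q (c + 2 * a - 1 - i - j))) := by
  obtain ⟨U, hU, hUm, hUe⟩ := exists_monic_pow_sub_pow (q ^ (c + 2 * a - 1))
  have e : (Matrix.of fun i j : Fin a => (q ^ ((i : ℕ) + 1)) ^ (j : ℕ) -
        (q ^ ((i : ℕ) + 1)) ^ (c + 2 * a - 1 - j)) =
      Matrix.of fun i j : Fin a => (q ^ (j : ℕ) - q ^ (c + 2 * a - 1 - j)) *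
        (Matrix.of fun i j : Fin a =>
          ((U j).eval (q ^ (i : ℕ) + q ^ (c + 2 * a - 1 - i)))).transpose i j := by
    ext i j
    have := j.isLt
    simp only [Matrix.of_apply, Matrix.transpose_apply]
    rw [← hUe i _ _ (by rw [← pow_add]; congr 1; omega)]
    simp only [← pow_mul, mul_comm]
  rw [e, Matrix.det_mul_row, Matrix.det_transpose,
    ← Matrix.det_eval_matrixOfPolynomials_eq_det_vandermonde _ (fun j : Fin a => U j)
      (fun j => hU j) (fun j => hUm j), Matrix.det_vandermonde, mul_mul_mul_comm]
  congr 1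
  · rw [← prod_mul_distrib]
    refine prod_congr rfl fun j _ => ?_
    have := j.isLt
    have h := pow_sub_pow_eq_qNat q (show (j : ℕ) ≤ c + 2 * a - 1 - j by omega)
    rw [show c + 2 * a - 1 - (j : ℕ) - j = c + 2 * a - 1 - 2 * j by omega] at h
    linear_combination -h
  · rw [← prod_mul_distrib]
    refine prod_congr rfl fun i _ => ?_
    rw [← prod_mul_distrib]
    refine prod_congr rfl fun j hj => ?_
    have hij : (i : ℕ) < j := Fin.lt_def.1 (mem_Ioi.1 hj)
    have hj' := j.isLt
    have h1 := pow_sub_pow_eq_qNat q hij.le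
    have h2 := pow_sub_one_eq_qNat q (c + 2 * a - 1 - i - j)
    have h3 : q ^ (c + 2 * a - 1 - (i : ℕ)) = q ^ (j : ℕ) * q ^ (c + 2 * a - 1 - i - j) := by
      rw [← pow_add]; congr 1; omega
    have h4 : q ^ (c + 2 * a - 1 - (j : ℕ)) = q ^ (i : ℕ) * q ^ (c + 2 * a - 1 - i - j) := by
      rw [← pow_add]; congr 1; omega
    rw [h3, h4]
    linear_combination (1 - q ^ (c + 2 * a - 1 - i - j)) * h1 -
      (q - 1) * (q ^ (i : ℕ) * qNat q (j - i)) * h2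

/-- The discrete Selberg-type evaluation underlying the count. -/
theorem sum_vandermonde_monoSeqs (a c : ℕ) :
    (∏ i : Fin a, ((i : ℝ) + 1)) * (∏ i : Fin a, ∏ j ∈ Ioi i, ((i : ℝ) + j + 2)) *
        ∑ l ∈ monoSeqs a (c + 1), ∏ i : Fin a, ∏ j ∈ Ioi i,
          (((l j + j : ℕ) : ℝ) - ((l i + i : ℕ) : ℝ)) =
      (∏ j : Fin a, ((c + 2 * a - 1 - 2 * j : ℕ) : ℝ)) * ∏ i : Fin a, ∏ j ∈ Ioi i,
          (((j : ℝ) - i) * ((c + 2 * a - 1 - i - j : ℕ) : ℝ)) := by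
  let L : ℝ → ℝ := fun q =>
    (∏ i : Fin a, qNat q (i + 1)) * (∏ i : Fin a, ∏ j ∈ Ioi i, qNat q (i + j + 2)) *
      ∑ l ∈ monoSeqs a (c + 1), ((∏ j : Fin a, q ^ (l j + (j : ℕ))) *
        ∏ i : Fin a, ∏ j ∈ Ioi i,
          (q ^ (l i + (i : ℕ)) * qNat q ((l j + j) - (l i + i))))
  let R : ℝ → ℝ := fun q =>
    (∏ j : Fin a, q ^ (j : ℕ) * qNat q (c + 2 * a - 1 - 2 * j)) *
        ∏ i : Fin a, ∏ j ∈ Ioi i,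
          (q ^ (i : ℕ) * qNat q (j - i) * qNat q (c + 2 * a - 1 - i - j))
  have hgt : ∀ q ∈ Set.Ioi (1 : ℝ), L q = R q := by
    intro q hq
    have hq1 : q - 1 ≠ 0 := sub_ne_zero.2 (ne_of_gt hq)
    have h := alternantSum_eq_det c (fun i : Fin a => q ^ ((i : ℕ) + 1))
      (fun i => one_lt_pow₀ hq (Nat.succ_ne_zero _))
    rw [det_principal, alternantSum,
      sum_congr rfl fun l hl => alternant_principal q (mem_monoSeqs.1 hl).2, ← mul_sum] at h
    have hC : (∏ _i : Fin a, (-(q - 1))) * ∏ i : Fin a, ∏ _j ∈ Ioi i, (-(q - 1) * (q - 1)) ≠ 0 :=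
      mul_ne_zero (prod_ne_zero_iff.2 fun _ _ => neg_ne_zero.2 hq1)
        (prod_ne_zero_iff.2 fun _ _ => prod_ne_zero_iff.2 fun _ _ =>
          mul_ne_zero (neg_ne_zero.2 hq1) hq1)
    apply mul_left_cancel₀ hC
    rw [← h]
    have e1 : ∏ i : Fin a, (1 - q ^ ((i : ℕ) + 1)) =
        (∏ _i : Fin a, (-(q - 1))) * ∏ i : Fin a, qNat q (i + 1) := by
      rw [← prod_mul_distrib]
      refine prod_congr rfl fun i _ => ?_
      linear_combination -pow_sub_one_eq_qNat q (i + 1)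
    have e2 : ∏ i : Fin a, ∏ j ∈ Ioi i, (1 - q ^ ((i : ℕ) + 1) * q ^ ((j : ℕ) + 1)) =
        (∏ i : Fin a, ∏ _j ∈ Ioi i, (-(q - 1))) *
          ∏ i : Fin a, ∏ j ∈ Ioi i, qNat q (i + j + 2) := by
      simp_rw [← prod_mul_distrib]
      refine prod_congr rfl fun i _ => prod_congr rfl fun j _ => ?_
      linear_combination -pow_sub_one_eq_qNat q (i + j + 2)
    rw [e1, e2]
    simp only [prod_mul_distrib, L]
    ring
  have hL : Continuous L := by
    have := continuous_qNat
    fun_prop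
  have hR : Continuous R := by
    have := continuous_qNat
    fun_prop
  have h1 : L 1 = R 1 := by
    have hsub : closure (Set.Ioi (1 : ℝ)) ⊆ {q | L q = R q} :=
      closure_minimal hgt (isClosed_eq hL hR)
    exact hsub (by rw [closure_Ioi]; exact Set.self_mem_Ici)
  simp only [L, R, qNat_one, one_pow, one_mul, prod_const_one] at h1
  convert h1 using 2
  · congr 1
    · exact prod_congr rfl fun i _ => by push_cast; ring
    · exact prod_congr rfl fun i _ => prod_congr rfl fun j _ => by push_cast; ring
  · refine sum_congr rfl fun l hl => prod_congr rfl fun i _ => prod_congr rfl fun j hj => ?_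
    have hij : i < j := mem_Ioi.1 hj
    have h1 := (mem_monoSeqs.1 hl).2 hij.le
    have h2 : (i : ℕ) < j := hij
    rw [Nat.cast_sub (by omega)]
  · refine prod_congr rfl fun i _ => prod_congr rfl fun j hj => ?_
    have hij : (i : ℕ) < j := Fin.lt_def.1 (mem_Ioi.1 hj)
    rw [Nat.cast_sub hij.le]

open Classical in
/-- Symmetric `a × a` arrays, weakly increasing along rows and columns, with entries below `n`. -/
noncomputable def symArrays (a n : ℕ) : Finset (Fin a → Fin a → ℕ) :=
  (Fintype.piFinset fun _ => Fintype.piFinset fun _ => range n).filter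
    fun h => (∀ i j, h i j = h j i) ∧ ∀ j, Monotone fun i => h i j

lemma mem_symArrays {a n : ℕ} {h : Fin a → Fin a → ℕ} :
    h ∈ symArrays a n ↔
      (∀ i j, h i j < n) ∧ (∀ i j, h i j = h j i) ∧ ∀ j, Monotone fun i => h i j := by
  simp [symArrays, Fintype.mem_piFinset]

lemma diag_mem_monoSeqs {a n : ℕ} {h : Fin a → Fin a → ℕ} (hh : h ∈ symArrays a n) :
    (fun i => h i i) ∈ monoSeqs a n := by
  obtain ⟨h1, h2, h3⟩ := mem_symArrays.1 hh
  refine mem_monoSeqs.2 ⟨fun i => h1 i i, fun i j hij => ?_⟩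
  calc h i i ≤ h j i := h3 i hij
    _ = h i j := h2 j i
    _ ≤ h j j := h3 j hij

/-- Number of symmetric arrays with prescribed main diagonal. -/
noncomputable def diagCount (a n : ℕ) (l : Fin a → ℕ) : ℕ :=
  ((symArrays a n).filter fun h => (fun i => h i i) = l).card

/-- The array with main diagonal `l` whose other diagonals are those of `h`. -/
def addDiag {a : ℕ} (l : Fin (a + 1) → ℕ) (h : Fin a → Fin a → ℕ) (i j : Fin (a + 1)) : ℕ :=
  if hij : i < j then h (i.castPred (Fin.ne_last_of_lt hij)) (j.pred (Fin.ne_zero_of_lt hij))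
  else if hji : j < i then h (j.castPred (Fin.ne_last_of_lt hji)) (i.pred (Fin.ne_zero_of_lt hji))
  else l i

lemma addDiag_self {a : ℕ} (l : Fin (a + 1) → ℕ) (h : Fin a → Fin a → ℕ) (i : Fin (a + 1)) :
    addDiag l h i i = l i := by simp [addDiag]

lemma addDiag_symm {a : ℕ} (l : Fin (a + 1) → ℕ) (h : Fin a → Fin a → ℕ) (i j : Fin (a + 1)) :
    addDiag l h i j = addDiag l h j i := by
  rcases lt_trichotomy i j with hij | rfl | hij
  · simp [addDiag, hij, hij.not_gt]
  · rfl
  · simp [addDiag, hij, hij.not_gt]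

lemma addDiag_castSucc_succ {a : ℕ} (l : Fin (a + 1) → ℕ) (h : Fin a → Fin a → ℕ) {i j : Fin a}
    (hij : i ≤ j) : addDiag l h i.castSucc j.succ = h i j := by
  have : i.castSucc < j.succ := Fin.castSucc_lt_succ_iff.2 hij
  simp [addDiag, this]

lemma addDiag_mem_symArrays {a n : ℕ} {l : Fin (a + 1) → ℕ} {h : Fin a → Fin a → ℕ}
    (hl : ∀ i, l i < n) (hh : h ∈ symArrays a n)
    (hlh : ∀ i, l i.castSucc ≤ h i i ∧ h i i ≤ l i.succ) :
    addDiag l h ∈ symArrays (a + 1) n := by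
  obtain ⟨h1, h2, h3⟩ := mem_symArrays.1 hh
  refine mem_symArrays.2 ⟨fun i j => ?_, addDiag_symm l h, fun j => ?_⟩
  · unfold addDiag
    split_ifs
    exacts [h1 _ _, h1 _ _, hl _]
  · refine Fin.monotone_iff_le_succ.2 fun i => ?_
    rcases lt_or_ge i.castSucc j with hij | hij
    · obtain ⟨j, rfl⟩ := Fin.exists_succ_eq.2 (Fin.ne_zero_of_lt hij)
      have hij' : i ≤ j := Fin.castSucc_lt_succ_iff.1 hij
      rw [addDiag_castSucc_succ l h hij']
      rcases hij'.eq_or_lt with rfl | hlt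
      · rw [addDiag_self]
        exact (hlh i).2
      · have : i.succ < j.succ := Fin.succ_lt_succ_iff.2 hlt
        simp only [addDiag, this, dif_pos, Fin.pred_succ]
        refine h3 j ?_
        rw [Fin.le_def]
        simp
    · have hj : j ≠ Fin.last a := by
        rintro rfl
        exact absurd (hij.trans_lt (Fin.castSucc_lt_last i)) (lt_irrefl _)
      obtain ⟨j, rfl⟩ := Fin.exists_castSucc_eq.2 hj
      have hij' : j ≤ i := Fin.castSucc_le_castSucc_iff.1 hij
      rw [addDiag_symm l h i.succ, addDiag_castSucc_succ l h hij']
      rcases hij'.eq_or_lt with rfl | hlt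
      · rw [addDiag_self]
        exact (hlh _).1
      · have : j.castSucc < i.castSucc := Fin.castSucc_lt_castSucc_iff.2 hlt
        rw [addDiag_symm]
        simp only [addDiag, this, dif_pos, Fin.castPred_castSucc]
        rw [h2 j, h2 j]
        refine h3 j ?_
        rw [Fin.le_def]
        simp

/-- The array obtained by deleting the main diagonal. -/
def dropDiag {a : ℕ} (h : Fin (a + 1) → Fin (a + 1) → ℕ) (i j : Fin a) : ℕ :=
  h (min i j).castSucc (max i j).succ

lemma dropDiag_mem_symArrays {a n : ℕ} {h : Fin (a + 1) → Fin (a + 1) → ℕ}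
    (hh : h ∈ symArrays (a + 1) n) : dropDiag h ∈ symArrays a n := by
  obtain ⟨h1, h2, h3⟩ := mem_symArrays.1 hh
  refine mem_symArrays.2 ⟨fun i j => h1 _ _, fun i j => ?_, fun j i i' hii => ?_⟩
  · simp only [dropDiag, min_comm, max_comm]
  · show h (min i j).castSucc (max i j).succ ≤ h (min i' j).castSucc (max i' j).succ
    calc h (min i j).castSucc (max i j).succ ≤ h (min i' j).castSucc (max i j).succ :=
          h3 _ (Fin.castSucc_le_castSucc_iff.2 (min_le_min_right j hii))
      _ = h (max i j).succ (min i' j).castSucc := h2 _ _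
      _ ≤ h (max i' j).succ (min i' j).castSucc :=
          h3 _ (Fin.succ_le_succ_iff.2 (max_le_max_right j hii))
      _ = _ := h2 _ _

lemma addDiag_dropDiag {a n : ℕ} {h : Fin (a + 1) → Fin (a + 1) → ℕ} {l : Fin (a + 1) → ℕ}
    (hh : h ∈ symArrays (a + 1) n) (hl : (fun i => h i i) = l) : addDiag l (dropDiag h) = h := by
  subst hl
  obtain ⟨-, h2, -⟩ := mem_symArrays.1 hh
  have key : ∀ i j, i < j → addDiag (fun i => h i i) (dropDiag h) i j = h i j := by
    intro i j hij
    obtain ⟨j, rfl⟩ := Fin.exists_succ_eq.2 (Fin.ne_zero_of_lt hij)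
    obtain ⟨i, rfl⟩ := Fin.exists_castSucc_eq.2 (Fin.ne_last_of_lt hij)
    have hij' : i ≤ j := Fin.castSucc_lt_succ_iff.1 hij
    rw [addDiag_castSucc_succ _ _ hij', dropDiag, min_eq_left hij', max_eq_right hij']
  funext i j
  rcases lt_trichotomy i j with hij | rfl | hij
  · exact key i j hij
  · exact addDiag_self _ _ _
  · rw [addDiag_symm, key j i hij, h2]

lemma dropDiag_addDiag {a n : ℕ} {h : Fin a → Fin a → ℕ} (l : Fin (a + 1) → ℕ)
    (hh : h ∈ symArrays a n) : dropDiag (addDiag l h) = h := by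
  obtain ⟨-, h2, -⟩ := mem_symArrays.1 hh
  funext i j
  rw [dropDiag, addDiag_castSucc_succ _ _ min_le_max]
  rcases le_total i j with hij | hij
  · rw [min_eq_left hij, max_eq_right hij]
  · rw [min_eq_right hij, max_eq_left hij, h2]

lemma dropDiag_self_mem {a n : ℕ} {h : Fin (a + 1) → Fin (a + 1) → ℕ}
    (hh : h ∈ symArrays (a + 1) n) (i : Fin a) :
    h i.castSucc i.castSucc ≤ dropDiag h i i ∧ dropDiag h i i ≤ h i.succ i.succ := by
  obtain ⟨-, h2, h3⟩ := mem_symArrays.1 hh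
  simp only [dropDiag, min_self, max_self]
  refine ⟨?_, h3 _ i.castSucc_lt_succ.le⟩
  rw [h2 _ i.succ]
  exact h3 _ i.castSucc_lt_succ.le

lemma diagCount_succ_eq_card {a n : ℕ} {l : Fin (a + 1) → ℕ} (hl : ∀ i, l i < n) :
    diagCount (a + 1) n l = ((symArrays a n).filter fun h =>
      ∀ i : Fin a, l i.castSucc ≤ h i i ∧ h i i ≤ l i.succ).card := by
  rw [diagCount]
  refine card_bij' (fun h _ => dropDiag h) (fun h _ => addDiag l h) ?_ ?_ ?_ ?_
  · intro h hh
    rw [mem_filter] at hh ⊢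
    refine ⟨dropDiag_mem_symArrays hh.1, ?_⟩
    rw [← hh.2]
    exact dropDiag_self_mem hh.1
  · intro h hh
    rw [mem_filter] at hh ⊢
    exact ⟨addDiag_mem_symArrays hl hh.1 hh.2, funext fun i => addDiag_self l h i⟩
  · intro h hh
    rw [mem_filter] at hh
    exact addDiag_dropDiag hh.1 hh.2
  · intro h hh
    rw [mem_filter] at hh
    exact dropDiag_addDiag l hh.1

lemma diagCount_succ {a n : ℕ} {l : Fin (a + 1) → ℕ} (hl : ∀ i, l i < n) :
    diagCount (a + 1) n l =
      ∑ m ∈ Fintype.piFinset fun i : Fin a => Icc (l i.castSucc) (l i.succ), diagCount a n m := by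
  rw [diagCount_succ_eq_card hl]
  have hmaps : ∀ h ∈ (symArrays a n).filter fun h =>
      ∀ i : Fin a, l i.castSucc ≤ h i i ∧ h i i ≤ l i.succ,
      (fun i => h i i) ∈ Fintype.piFinset fun i : Fin a => Icc (l i.castSucc) (l i.succ) := by
    intro h hh
    rw [mem_filter] at hh
    exact Fintype.mem_piFinset.2 fun i => mem_Icc.2 (hh.2 i)
  rw [card_eq_sum_card_fiberwise hmaps]
  refine sum_congr rfl fun m hm => ?_
  rw [diagCount, filter_filter]
  congr 1
  refine filter_congr fun h _ => ⟨fun hh => hh.2, fun hh => ⟨fun i => ?_, hh⟩⟩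
  have := mem_Icc.1 (Fintype.mem_piFinset.1 hm i)
  rwa [← hh] at this

lemma sum_Icc_choose_add (i j p r : ℕ) (h : p ≤ r) :
    ∑ m ∈ Icc p r, (((m + i).choose j : ℕ) : ℝ) =
      ((r + i + 1).choose (j + 1) : ℕ) - ((p + i).choose (j + 1) : ℕ) := by
  induction r, h using Nat.le_induction with
  | base =>
    rw [Icc_self, sum_singleton, Nat.choose_succ_succ']
    push_cast
    ring
  | succ r hr ih =>
    rw [← insert_Icc_right_eq_Icc_add_one (by omega), sum_insert (by simp), ih,
      show r + 1 + i = r + i + 1 by ring, Nat.choose_succ_succ' (r + i + 1) j]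
    push_cast
    ring

lemma diagCount_eq_det {a n : ℕ} {l : Fin a → ℕ} (hl : l ∈ monoSeqs a n) :
    (diagCount a n l : ℝ) =
      (Matrix.of fun i j : Fin a => (((l i + i).choose j : ℕ) : ℝ)).det := by
  induction a with
  | zero =>
    have : (symArrays 0 n).filter (fun h => (fun i => h i i) = l) = univ := by
      ext h
      simp only [mem_filter, mem_symArrays, mem_univ, iff_true]
      exact ⟨⟨fun i => i.elim0, fun i => i.elim0, fun i => i.elim0⟩, Subsingleton.elim _ _⟩
    rw [diagCount, this]
    simp
  | succ a ih =>
    obtain ⟨h1, h2⟩ := mem_monoSeqs.1 hl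
    have hmono : ∀ i : Fin a, l i.castSucc ≤ l i.succ := fun i => h2 i.castSucc_lt_succ.le
    rw [diagCount_succ h1, Nat.cast_sum, sum_congr rfl fun m hm => ih (l := m) ?_]
    · have e1 := (Matrix.detRowAlternating (n := Fin a) (R := ℝ)).toMultilinearMap.map_sum_finset
        (fun i (m : ℕ) (j : Fin a) => (((m + i).choose j : ℕ) : ℝ))
        (fun i : Fin a => Icc (l i.castSucc) (l i.succ))
      refine (e1.symm.trans ?_)
      let B : Matrix (Fin (a + 1)) (Fin (a + 1)) ℝ := Matrix.of fun i j =>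
        Fin.cases (((l 0 + 0).choose j : ℕ) : ℝ) (fun i : Fin a =>
          (((l i.succ + (i + 1 : ℕ)).choose j : ℕ) : ℝ) -
            (((l i.castSucc + (i : ℕ)).choose j : ℕ) : ℝ)) i
      have hB : (Matrix.of fun i j : Fin (a + 1) => (((l i + i).choose j : ℕ) : ℝ)).det =
          B.det := by
        refine Matrix.det_eq_of_forall_row_eq_smul_add_pred (fun _ => 1) (fun j => by simp [B]) ?_
        intro i j
        simp [B]
      rw [hB, Matrix.det_succ_column_zero, Fin.sum_univ_succ, sum_eq_zero]
      · simp only [Fin.val_zero, pow_zero, one_mul, add_zero, B, Matrix.of_apply, Fin.cases_zero,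
          Nat.choose_zero_right, Nat.cast_one]
        show Matrix.det _ = Matrix.det _
        congr 1
        ext i j
        rw [Finset.sum_apply, sum_Icc_choose_add _ _ _ _ (hmono i)]
        simp [add_assoc]
      · intro i _
        simp [B]
    · refine mem_monoSeqs.2 ⟨fun i => ?_, ?_⟩
      · exact (mem_Icc.1 (Fintype.mem_piFinset.1 hm i)).2.trans_lt (h1 _)
      · intro i j hij
        rcases hij.eq_or_lt with rfl | hlt
        · rfl
        · exact (mem_Icc.1 (Fintype.mem_piFinset.1 hm i)).2.trans
            ((h2 (Fin.succ_le_castSucc_iff.2 hlt)).trans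
              (mem_Icc.1 (Fintype.mem_piFinset.1 hm j)).1)

lemma card_symArrays (a n : ℕ) :
    ((symArrays a n).card : ℝ) = ∑ l ∈ monoSeqs a n,
      (Matrix.of fun i j : Fin a => (((l i + i).choose j : ℕ) : ℝ)).det := by
  rw [card_eq_sum_card_fiberwise (f := fun h i => h i i) (t := monoSeqs a n)
    (fun h hh => diag_mem_monoSeqs hh), Nat.cast_sum]
  exact sum_congr rfl fun l hl => diagCount_eq_det hl

lemma det_choose_mul_prod_factorial {a : ℕ} (v : Fin a → ℕ) :
    (Matrix.of fun i j : Fin a => (((v i).choose j : ℕ) : ℝ)).det *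
        ∏ j : Fin a, ((j : ℕ).factorial : ℝ) =
      ∏ i, ∏ j ∈ Ioi i, ((v j : ℝ) - v i) := by
  rw [← Matrix.det_vandermonde (fun i => (v i : ℝ)),
    Matrix.det_eval_matrixOfPolynomials_eq_det_vandermonde _
      (fun i : Fin a => descPochhammer ℝ i) (fun i => descPochhammer_natDegree ℝ i)
      (fun i => monic_descPochhammer ℝ i), mul_comm, ← Matrix.det_mul_row]
  congr 1
  ext i j
  simp only [Matrix.of_apply]
  rw [descPochhammer_eval_eq_descFactorial, Nat.descFactorial_eq_factorial_mul_choose, Nat.cast_mul]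

lemma prod_factorial_eq_prod_sub (a : ℕ) :
    ∏ j : Fin a, ((j : ℕ).factorial : ℝ) = ∏ i : Fin a, ∏ j ∈ Ioi i, (((j : ℕ) : ℝ) - (i : ℕ)) := by
  rw [← det_choose_mul_prod_factorial, Matrix.det_of_isLowerTriangular]
  · simp
  · intro i j hij
    simp only [Matrix.of_apply, Nat.cast_eq_zero]
    exact Nat.choose_eq_zero_of_lt hij

lemma card_symArrays_mul (a c : ℕ) :
    ((symArrays a (c + 1)).card : ℝ) * ((∏ i : Fin a, ((i : ℝ) + 1)) *
        ∏ i : Fin a, ∏ j ∈ Ioi i, ((i : ℝ) + j + 2)) =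
      (∏ j : Fin a, ((c + 2 * a - 1 - 2 * j : ℕ) : ℝ)) *
        ∏ i : Fin a, ∏ j ∈ Ioi i, ((c + 2 * a - 1 - i - j : ℕ) : ℝ) := by
  have hne : ∏ i : Fin a, ∏ j ∈ Ioi i, (((j : ℕ) : ℝ) - (i : ℕ)) ≠ 0 := by
    rw [← prod_factorial_eq_prod_sub]
    exact prod_ne_zero_iff.2 fun j _ => Nat.cast_ne_zero.2 (Nat.factorial_ne_zero _)
  have hC := sum_vandermonde_monoSeqs a c
  have hA : ((symArrays a (c + 1)).card : ℝ) *
      ∏ i : Fin a, ∏ j ∈ Ioi i, (((j : ℕ) : ℝ) - (i : ℕ)) =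
      ∑ l ∈ monoSeqs a (c + 1),
        ∏ i, ∏ j ∈ Ioi i, (((l j + j : ℕ) : ℝ) - ((l i + i : ℕ) : ℝ)) := by
    rw [card_symArrays, sum_mul, ← prod_factorial_eq_prod_sub]
    exact sum_congr rfl fun l _ => det_choose_mul_prod_factorial fun i => l i + i
  rw [← hA] at hC
  simp only [prod_mul_distrib] at hC
  apply mul_right_cancel₀ hne
  linear_combination hC

lemma prod_add_one_mul_prod_pairs (a : ℕ) :
    (∏ i : Fin a, ((i : ℝ) + 1)) * ∏ i : Fin a, ∏ j ∈ Ioi i, ((i : ℝ) + j + 2) =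
      (∏ i : Fin a, (2 * (i : ℝ) + 1)) * ∏ i : Fin a, ∏ j ∈ Ioi i, ((i : ℝ) + j + 1) := by
  induction a with
  | zero => simp
  | succ a ih =>
    rw [prod_pairs_succAbove (fun i j : Fin (a + 1) => (i : ℝ) + j + 2)
        (fun i j => by ring) (Fin.last a),
      prod_pairs_succAbove (fun i j : Fin (a + 1) => (i : ℝ) + j + 1)
        (fun i j => by ring) (Fin.last a), Fin.prod_univ_castSucc, Fin.prod_univ_castSucc]
    simp only [Fin.succAbove_last, Fin.val_castSucc, Fin.val_last]
    have key : ((a : ℝ) + 1) * ∏ k : Fin a, ((a : ℝ) + k + 2) =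
        (2 * a + 1) * ∏ k : Fin a, ((a : ℝ) + k + 1) := by
      rw [Fin.prod_univ_eq_prod_range (fun k => (a : ℝ) + k + 2),
        Fin.prod_univ_eq_prod_range (fun k => (a : ℝ) + k + 1)]
      have h1 := prod_range_succ (fun k : ℕ => (a : ℝ) + k + 1) a
      have h2 := prod_range_succ' (fun k : ℕ => (a : ℝ) + k + 1) a
      have h3 : ∏ k ∈ range a, ((a : ℝ) + ((k + 1 : ℕ) : ℝ) + 1) =
          ∏ k ∈ range a, ((a : ℝ) + k + 2) :=
        prod_congr rfl fun k _ => by push_cast; ring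
      rw [h3, h1] at h2
      push_cast at h2
      linear_combination -h2
    linear_combination ((a : ℝ) + 1) * (∏ k : Fin a, ((a : ℝ) + k + 2)) * ih +
      (∏ i : Fin a, (2 * (i : ℝ) + 1)) * (∏ i : Fin a, ∏ j ∈ Ioi i, ((i : ℝ) + j + 1)) * key

lemma prod_pairs_eq_prod_filter {M : Type*} [CommMonoid M] {a : ℕ} (f : Fin a → Fin a → M) :
    ∏ i, ∏ j ∈ Ioi i, f i j =
      ∏ p ∈ univ.filter (fun p : Fin a × Fin a => p.1 < p.2), f p.1 p.2 := by
  rw [prod_filter, Fintype.prod_prod_type]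
  refine prod_congr rfl fun i _ => ?_
  rw [← prod_filter]
  refine prod_congr ?_ fun _ _ => rfl
  ext j
  simp

lemma prod_pairs_rev {M : Type*} [CommMonoid M] {a : ℕ} (f : Fin a → Fin a → M) :
    ∏ p ∈ univ.filter (fun p : Fin a × Fin a => p.1 < p.2), f p.1 p.2 =
      ∏ p ∈ univ.filter (fun p : Fin a × Fin a => p.1 < p.2), f p.2.rev p.1.rev := by
  refine prod_nbij' (fun p => (p.2.rev, p.1.rev)) (fun p => (p.2.rev, p.1.rev)) ?_ ?_ ?_ ?_ ?_ <;>
    simp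

theorem card_symArrays_mul_eq (a c : ℕ) :
    (symArrays a (c + 1)).card * (∏ i : Fin a, (2 * ((i : ℕ) + 1) - 1)) *
        (∏ p ∈ univ.filter fun p : Fin a × Fin a => p.1 < p.2,
          (((p.1 : ℕ) + 1) + ((p.2 : ℕ) + 1) - 1)) =
      (∏ i : Fin a, (c + 2 * ((i : ℕ) + 1) - 1)) *
        (∏ p ∈ univ.filter fun p : Fin a × Fin a => p.1 < p.2,
          (c + ((p.1 : ℕ) + 1) + ((p.2 : ℕ) + 1) - 1)) := by
  have h := card_symArrays_mul a c
  rw [prod_add_one_mul_prod_pairs, prod_pairs_eq_prod_filter, prod_pairs_eq_prod_filter,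
    prod_pairs_rev (fun i j : Fin a => ((c + 2 * a - 1 - i - j : ℕ) : ℝ)),
    ← Equiv.prod_comp Fin.revPerm (fun j : Fin a => ((c + 2 * a - 1 - 2 * j : ℕ) : ℝ)),
    ← mul_assoc] at h
  have e1 : ∀ i : Fin a, c + 2 * a - 1 - 2 * (Fin.revPerm i : Fin a) = 
      c + 2 * ((i : ℕ) + 1) - 1 := by
    intro i
    rw [Fin.revPerm_apply, Fin.val_rev]
    omega
  have e2 : ∀ i j : Fin a, c + 2 * a - 1 - (j.rev : Fin a) - (i.rev : Fin a) =
      c + ((i : ℕ) + 1) + ((j : ℕ) + 1) - 1 := by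
    intro i j
    rw [Fin.val_rev, Fin.val_rev]
    omega
  simp only [e1, e2] at h
  have e3 : ∀ i : Fin a, (2 * (i : ℝ) + 1) = ((2 * ((i : ℕ) + 1) - 1 : ℕ) : ℝ) := by
    intro i
    rw [show 2 * ((i : ℕ) + 1) - 1 = 2 * i + 1 by omega]
    push_cast
    ring
  have e4 : ∀ i j : Fin a, ((i : ℝ) + j + 1) = ((((i : ℕ) + 1) + ((j : ℕ) + 1) - 1 : ℕ) : ℝ) := by
    intro i j
    rw [show (i : ℕ) + 1 + (j + 1) - 1 = i + j + 1 by omega]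
    push_cast
    ring
  simp only [e3, e4] at h
  exact_mod_cast h

lemma mem_iff_lt_card {c : ℕ} {S : Finset (Fin c)} (hS : ∀ k ∈ S, ∀ k' ≤ k, k' ∈ S) (k : Fin c) :
    k ∈ S ↔ (k : ℕ) < S.card := by
  constructor
  · intro hk
    have : Iic k ⊆ S := fun k' hk' => hS k hk k' (mem_Iic.1 hk')
    have := card_le_card this
    rw [Fin.card_Iic] at this
    omega
  · intro hk
    by_contra hkS
    have : S ⊆ Iio k := fun k' hk' => mem_Iio.2 (lt_of_not_ge fun h => hkS (hS k' hk' k h))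
    have := card_le_card this
    rw [Fin.card_Iio] at this
    omega

/-- The vertical section of `T` above `(i, j)`. -/
def column {a b c : ℕ} (T : Finset (Fin a × Fin b × Fin c)) (i : Fin a) (j : Fin b) :
    Finset (Fin c) :=
  univ.filter fun k => (i, j, k) ∈ T

lemma mem_column {a b c : ℕ} {T : Finset (Fin a × Fin b × Fin c)} {i : Fin a} {j : Fin b}
    {k : Fin c} : k ∈ column T i j ↔ (i, j, k) ∈ T := by
  simp [column]

lemma mem_iff_lt_card_column {a b c : ℕ} {T : Finset (Fin a × Fin b × Fin c)} (hT : IsPP a b c T)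
    (i : Fin a) (j : Fin b) (k : Fin c) : (i, j, k) ∈ T ↔ (k : ℕ) < (column T i j).card := by
  rw [← mem_column]
  exact mem_iff_lt_card (fun k hk k' hk' => mem_column.2
    (hT _ (mem_column.1 hk) _ le_rfl le_rfl hk')) k

lemma ppTau_eq_self_iff {a c : ℕ} {T : Finset (Fin a × Fin a × Fin c)} :
    ppTau a c T = T ↔ ∀ i j k, (i, j, k) ∈ T ↔ (j, i, k) ∈ T := by
  have hmem : ∀ i j k, (i, j, k) ∈ ppTau a c T ↔ (j, i, k) ∈ T := by
    intro i j k
    simp only [ppTau, mem_image, Prod.mk.injEq]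
    constructor
    · rintro ⟨⟨x, y, z⟩, h, rfl, rfl, rfl⟩
      exact h
    · intro h
      exact ⟨_, h, rfl, rfl, rfl⟩
  constructor
  · intro h i j k
    rw [← hmem, h]
  · intro h
    ext ⟨i, j, k⟩
    rw [hmem, h]

/-- The plane partition whose column above `(i, j)` has height `c - h i j`. -/
def ofCoheights {a c : ℕ} (h : Fin a → Fin a → ℕ) : Finset (Fin a × Fin a × Fin c) :=
  univ.filter fun p => (p.2.2 : ℕ) + h p.1 p.2.1 < c

lemma mem_ofCoheights {a c : ℕ} {h : Fin a → Fin a → ℕ} {i j : Fin a} {k : Fin c} :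
    (i, j, k) ∈ ofCoheights h ↔ (k : ℕ) + h i j < c := by
  simp [ofCoheights]

lemma card_column_ofCoheights {a c : ℕ} (h : Fin a → Fin a → ℕ) (i j : Fin a) :
    (column (ofCoheights h : Finset (Fin a × Fin a × Fin c)) i j).card = c - h i j := by
  have : (column (ofCoheights h : Finset (Fin a × Fin a × Fin c)) i j) =
      univ.filter fun k : Fin c => (k : ℕ) < c - h i j := by
    ext k
    rw [mem_column, mem_ofCoheights, mem_filter]
    have := k.2
    simp only [mem_univ, true_and]
    omega
  rw [this, Fin.card_filter_val_lt]
  omega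

lemma card_symmetric_planePartitions (a c : ℕ) :
    (univ.filter fun T : Finset (Fin a × Fin a × Fin c) =>
        IsPP a a c T ∧ ppTau a c T = T).card = (symArrays a (c + 1)).card := by
  have hcard : ∀ (T : Finset (Fin a × Fin a × Fin c)) i j, (column T i j).card ≤ c :=
    fun T i j => by simpa using card_le_univ (column T i j)
  refine card_bij' (fun T _ i j => c - (column T i j).card) (fun h _ => ofCoheights h) ?_ ?_ ?_ ?_
  · intro T hT
    rw [mem_filter] at hT
    obtain ⟨-, hPP, hsymm⟩ := hT
    rw [ppTau_eq_self_iff] at hsymm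
    refine mem_symArrays.2 ⟨fun i j => by omega, fun i j => ?_, fun j i i' hii => ?_⟩
    · have : column T i j = column T j i := by
        ext k
        rw [mem_column, mem_column, hsymm]
      rw [this]
    · refine Nat.sub_le_sub_left (card_le_card fun k hk => ?_) c
      exact mem_column.2 (hPP _ (mem_column.1 hk) _ hii le_rfl le_rfl)
  · intro h hh
    obtain ⟨-, h2, h3⟩ := mem_symArrays.1 hh
    rw [mem_filter, ppTau_eq_self_iff]
    refine ⟨mem_univ _, ?_, fun i j k => ?_⟩
    · rintro ⟨i, j, k⟩ hp ⟨i', j', k'⟩ hi hj hk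
      rw [mem_ofCoheights] at hp ⊢
      have e1 : h i' j' ≤ h i j' := h3 j' hi
      have e2 : h i j' ≤ h i j := by
        rw [h2 i j', h2 i j]
        exact h3 i hj
      have e3 : (k' : ℕ) ≤ k := hk
      omega
    · rw [mem_ofCoheights, mem_ofCoheights, h2]
  · intro T hT
    rw [mem_filter] at hT
    ext ⟨i, j, k⟩
    rw [mem_ofCoheights, mem_iff_lt_card_column hT.2.1]
    have := hcard T i j
    omega
  · intro h hh
    obtain ⟨h1, -, -⟩ := mem_symArrays.1 hh
    funext i j
    rw [card_column_ofCoheights]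
    have := h1 i j
    omega

/-- The number of symmetric plane partitions in an `a × a × c` box satisfies
`N_τ(a,a,c) ∏_{i=1}^a (2i-1) ∏_{1 ≤ i<j ≤ a} (i+j-1)
  = ∏_{i=1}^a (c+2i-1) ∏_{1 ≤ i<j ≤ a} (c+i+j-1)`.
(Below, indices `i, j : Fin a` are zero-based, so `i+1`, `j+1` range over `1, …, a`.) -/
theorem symmetric_planePartition_count (a c : ℕ) :
    (Finset.univ.filter fun T : Finset (Fin a × Fin a × Fin c) =>
        IsPP a a c T ∧ ppTau a c T = T).card *
        (∏ i : Fin a, (2 * ((i : ℕ) + 1) - 1)) *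
        (∏ p ∈ Finset.univ.filter fun p : Fin a × Fin a => p.1 < p.2,
          (((p.1 : ℕ) + 1) + ((p.2 : ℕ) + 1) - 1)) =
      (∏ i : Fin a, (c + 2 * ((i : ℕ) + 1) - 1)) *
        (∏ p ∈ Finset.univ.filter fun p : Fin a × Fin a => p.1 < p.2,
          (c + ((p.1 : ℕ) + 1) + ((p.2 : ℕ) + 1) - 1)) := by
  rw [card_symmetric_planePartitions]
  exact card_symArrays_mul_eq a c
end

section
/- (The Hodge star relative to B sends x_P to x_{τ(P)}.) For all partitions Q and P in the a×a rectangle, x_Q ∧ x_P = det(M) · e₁ ∧ … ∧ e_{2a} in Λ^{2a} ℂ^{2a}, where M is the a×a matrix with (i,j) entry B(e_{q_i}, e_{r_j}), q₁ < … < q_a the increasing enumeration of S(Q), and r₁ < … < r_a the increasing enumeration of S(τ(P)). -/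
open Finset

/-- A partition in an `a × b` rectangle, given by its weakly decreasing sequence of
row lengths `λ₁ ≥ λ₂ ≥ ⋯ ≥ λ_a` with `0 ≤ λᵢ ≤ b` (zero-based indexing). -/
def IsRect (a b : ℕ) (lam : Fin a → ℕ) : Prop :=
  Antitone lam ∧ ∀ i, lam i ≤ b

/-- The down-step set `S(P) = {λᵢ + a + 1 - i : 1 ≤ i ≤ a} ⊆ {1, …, a+b}`
(the zero-based row `i : Fin a` contributes `λ_{i+1} + a + 1 - (i+1) = lam i + a - i`). -/
def downSteps (a : ℕ) (lam : Fin a → ℕ) : Finset ℕ :=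
  Finset.univ.image fun i : Fin a => lam i + a - (i : ℕ)

/-- Complementation of a partition with `a` rows in a rectangle of width `m`:
the row lengths are `(m - λ_{a+1-i})_{i=1}^{a}`. -/
def seqKappa (a m : ℕ) (lam : Fin a → ℕ) : Fin a → ℕ := fun i => m - lam i.rev

/-- Transposition of a partition in an `a × b` rectangle: `τ(λ)_j = #{i : λᵢ ≥ j}`
(zero-based: `τ(λ) j = #{i : lam i > j}`), a partition in the `b × a` rectangle. -/
def seqTau (a b : ℕ) (lam : Fin a → ℕ) : Fin b → ℕ :=
  fun j => (Finset.univ.filter fun i : Fin a => (j : ℕ) < lam i).card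

/-- The standard basis vector `e_n` (one-based `n`) of `ℂ^d`. -/
def eb (d n : ℕ) : Fin d → ℂ := fun m => if (m : ℕ) + 1 = n then 1 else 0

/-- The increasing enumeration `s₁ < s₂ < ⋯ < s_a` of the down-step set `S(P)`
(zero-based: `k ↦ s_{k+1}`); for an antitone `lam` the map
`i ↦ lam i + a - i` is strictly decreasing, so we reverse the index. -/
def sInc (a : ℕ) (lam : Fin a → ℕ) : Fin a → ℕ :=
  fun k => lam k.rev + a - (k.rev : ℕ)

/-- The wedge `x_P = e_{s₁} ∧ ⋯ ∧ e_{s_a} ∈ Λ^a ℂ^d` for `S(P) = {s₁ < ⋯ < s_a}`. -/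
noncomputable def xWedge (d a : ℕ) (lam : Fin a → ℕ) :
    ExteriorAlgebra ℂ (Fin d → ℂ) :=
  ExteriorAlgebra.ιMulti ℂ a fun k => eb d (sInc a lam k)

/-- The top wedge `e₁ ∧ e₂ ∧ ⋯ ∧ e_d ∈ Λ^d ℂ^d`. -/
noncomputable def topWedge (d : ℕ) : ExteriorAlgebra ℂ (Fin d → ℂ) :=
  ExteriorAlgebra.ιMulti ℂ d fun m => eb d ((m : ℕ) + 1)

/-- The bilinear form `B` on `ℂ^{2a}` in coordinates (one-based indices):
`B(e_n, e_k) = (-1)^{n+1}` if `k = 2a+1-n` and `0` otherwise. -/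
def Bform (a n k : ℕ) : ℂ := if n + k = 2 * a + 1 then (-1 : ℂ) ^ (n + 1) else 0

theorem IsRect.seqTau {a b : ℕ} (lam : Fin a → ℕ) : IsRect b a (seqTau a b lam) := by
  refine ⟨fun i j hij => card_le_card fun k hk => ?_, fun i => ?_⟩
  · simp only [mem_filter, mem_univ, true_and] at hk ⊢
    exact lt_of_le_of_lt hij hk
  · exact (card_filter_le _ _).trans (by simp)

theorem sInc_strictMono {a : ℕ} {lam : Fin a → ℕ} (h : Antitone lam) : StrictMono (sInc a lam) := by
  intro i j hij
  have hrev : j.rev < i.rev := Fin.rev_lt_rev.2 hij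
  have := h hrev.le
  have hlt : (j.rev : ℕ) < i.rev := hrev
  have := i.rev.isLt
  simp only [sInc]
  omega

theorem sInc_mem_Icc {a b : ℕ} {lam : Fin a → ℕ} (h : IsRect a b lam) (i : Fin a) :
    sInc a lam i ∈ Icc 1 (a + b) := by
  have := h.2 i.rev
  have := i.rev.isLt
  simp only [sInc, mem_Icc]
  omega

/-- Row `i` has length greater than `j` exactly when column `j` has length greater than `i`. -/
theorem lt_seqTau_iff {a b : ℕ} {lam : Fin a → ℕ} (h : Antitone lam) (i : Fin a) (j : Fin b) :
    (i : ℕ) < seqTau a b lam j ↔ (j : ℕ) < lam i := by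
  constructor
  · intro hi
    by_contra! hj
    have hsub : univ.filter (fun k : Fin a => (j : ℕ) < lam k) ⊆ Iio i := fun k hk => by
      simp only [mem_filter, mem_univ, true_and, mem_Iio] at hk ⊢
      by_contra! hik
      exact absurd (h hik) (by omega)
    have := card_le_card hsub
    rw [Fin.card_Iio] at this
    exact absurd hi (not_lt.2 this)
  · intro hj
    have hsub : Iic i ⊆ univ.filter (fun k : Fin a => (j : ℕ) < lam k) := fun k hk => by
      simp only [mem_filter, mem_univ, true_and, mem_Iic] at hk ⊢
      exact hj.trans_le (h hk)
    have := card_le_card hsub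
    rw [Fin.card_Iic] at this
    exact this

/-- No down-step of `P` is the reflection of a down-step of its transpose. -/
theorem sInc_add_sInc_seqTau_ne {a b : ℕ} {lam : Fin a → ℕ} (h : Antitone lam)
    (i : Fin a) (j : Fin b) : sInc a lam i + sInc b (seqTau a b lam) j ≠ a + b + 1 := by
  have := lt_seqTau_iff h i.rev j.rev
  have := i.rev.isLt
  have := j.rev.isLt
  simp only [sInc]
  omega

theorem prod_Ioi_sign_of_forall_lt {n : ℕ} (σ : Equiv.Perm (Fin n)) (i : Fin n)
    (h : ∀ k < i, σ k < σ i) :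
    ∏ j ∈ Ioi i, (if σ i < σ j then 1 else -1 : ℤˣ) = (-1) ^ ((σ i : ℕ) + i) := by
  have hsplit : (Iio (σ i)).map σ.symm.toEmbedding =
      (Iio i).disjUnion ((Ioi i).filter fun j => ¬ σ i < σ j)
        (disjoint_left.2 fun k hk hk' => by
          simp only [mem_Iio, mem_filter, mem_Ioi] at hk hk'
          exact lt_asymm hk hk'.1) := by
    ext k
    simp only [mem_map_equiv, Equiv.symm_symm, mem_Iio, mem_disjUnion, mem_filter, mem_Ioi, not_lt]
    constructor
    · intro hk
      rcases lt_trichotomy k i with hlt | rfl | hgt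
      · exact .inl hlt
      · exact absurd hk (lt_irrefl _)
      · exact .inr ⟨hgt, hk.le⟩
    · rintro (hk | ⟨hk, hle⟩)
      · exact h k hk
      · exact lt_of_le_of_ne hle fun he => hk.ne' (σ.injective he)
  have hcard := congrArg card hsplit
  rw [card_map, card_disjUnion, Fin.card_Iio, Fin.card_Iio] at hcard
  rw [prod_ite, prod_const_one, one_mul, prod_const, hcard, add_right_comm, ← two_mul,
    pow_add, pow_mul]
  simp

/-- The sign of a shuffle. -/
theorem sign_eq_prod_of_strictMono_append {m n : ℕ} (σ : Equiv.Perm (Fin (m + n)))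
    (hl : StrictMono fun i => σ (Fin.castAdd n i)) (hr : StrictMono fun i => σ (Fin.natAdd m i)) :
    σ.sign = ∏ i : Fin m, (-1) ^ ((σ (Fin.castAdd n i) : ℕ) + i) := by
  rw [Equiv.Perm.sign_eq_prod_prod_Ioi, Fin.prod_univ_add]
  have hone : ∀ i : Fin n, ∏ j ∈ Ioi (Fin.natAdd m i),
      (if σ (Fin.natAdd m i) < σ j then 1 else -1 : ℤˣ) = 1 := fun i => by
    refine prod_eq_one fun j hj => ?_
    rw [mem_Ioi] at hj
    induction j using Fin.addCases with
    | left j =>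
      have : m + (i : ℕ) < j := hj
      omega
    | right j => exact if_pos (hr ((Fin.natAdd_lt_natAdd_iff m).1 hj))
  rw [prod_congr rfl fun i _ => hone i, prod_const_one, mul_one]
  refine prod_congr rfl fun i _ => ?_
  rw [prod_Ioi_sign_of_forall_lt, Fin.val_castAdd]
  intro k hk
  have hk' : (k : ℕ) < i := hk
  have := hl (a := ⟨k, hk'.trans i.isLt⟩) (b := i) hk'
  exact this

theorem sign_revPerm (n : ℕ) : (Fin.revPerm (n := n)).sign = ∏ i : Fin n, (-1) ^ (i : ℕ) := by
  rw [Equiv.Perm.sign_eq_prod_prod_Iio]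
  refine prod_congr rfl fun j _ => ?_
  rw [prod_congr rfl fun i hi => if_neg ?_, prod_const, Fin.card_Iio]
  simpa using (mem_Iio.1 hi).le

theorem det_Bform_of_add_eq {a : ℕ} {q r : Fin a → ℕ} (hq : Function.Injective q)
    (h : ∀ i, q i + r i.rev = 2 * a + 1) :
    (Matrix.of fun i j : Fin a => Bform a (q i) (r j)).det =
      ∏ i : Fin a, (-1 : ℂ) ^ (q i + 1 + i) := by
  have hM : (Matrix.of fun i j : Fin a => Bform a (q i) (r j)).submatrix id Fin.revPerm =
      Matrix.diagonal fun i => (-1 : ℂ) ^ (q i + 1) := by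
    ext i j
    simp only [Matrix.submatrix_apply, Matrix.of_apply, Bform, id, Fin.revPerm_apply,
      Matrix.diagonal_apply]
    refine if_congr ⟨fun hij => hq ?_, ?_⟩ rfl rfl
    · have := h j
      omega
    · rintro rfl
      exact h i
  have hdet := congrArg Matrix.det hM
  rw [Matrix.det_permute', Matrix.det_diagonal, sign_revPerm] at hdet
  have hsq : (∏ i : Fin a, (-1 : ℂ) ^ (i : ℕ)) * ∏ i : Fin a, (-1 : ℂ) ^ (i : ℕ) = 1 := by
    rw [← prod_mul_distrib]
    exact prod_eq_one fun i _ => by rw [← pow_add, ← two_mul, pow_mul]; simp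
  push_cast at hdet
  simp only [pow_add _ (_ + 1), prod_mul_distrib]
  rw [← hdet, mul_comm, ← mul_assoc, hsq, one_mul]

/-- The product of two increasing wedges of standard basis vectors with complementary
supports. -/
theorem ιMulti_eb_mul_ιMulti_eb {m n : ℕ} {q : Fin m → ℕ} {p : Fin n → ℕ}
    (hq : StrictMono q) (hp : StrictMono p) (hqm : ∀ i, q i ∈ Icc 1 (m + n))
    (hpm : ∀ i, p i ∈ Icc 1 (m + n)) (hne : ∀ i j, q i ≠ p j) :
    (ExteriorAlgebra.ιMulti ℂ m fun k => eb (m + n) (q k)) *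
        (ExteriorAlgebra.ιMulti ℂ n fun k => eb (m + n) (p k)) =
      (∏ i : Fin m, (-1 : ℂ) ^ (q i + 1 + i)) • topWedge (m + n) := by
  simp only [mem_Icc] at hqm hpm
  let f : Fin (m + n) → Fin (m + n) := Fin.append
    (fun i => ⟨q i - 1, by have := hqm i; omega⟩) (fun i => ⟨p i - 1, by have := hpm i; omega⟩)
  have hfl (i : Fin m) : (f (Fin.castAdd n i) : ℕ) = q i - 1 := by simp [f]
  have hfr (i : Fin n) : (f (Fin.natAdd m i) : ℕ) = p i - 1 := by simp [f]
  have hf : Function.Injective f := by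
    refine Fin.append_injective_iff.2 ⟨fun i j hij => hq.injective ?_,
      fun i j hij => hp.injective ?_, fun i j hij => hne i j ?_⟩ <;> rw [Fin.mk.injEq] at hij
    · have := hqm i; have := hqm j; omega
    · have := hpm i; have := hpm j; omega
    · have := hqm i; have := hpm j; omega
  let σ : Equiv.Perm (Fin (m + n)) := Equiv.ofBijective f (Finite.injective_iff_bijective.1 hf)
  have hσ : σ.sign = ∏ i : Fin m, (-1) ^ (q i + 1 + i) := by
    rw [sign_eq_prod_of_strictMono_append σ (fun i j hij => ?_) (fun i j hij => ?_)]
    · refine prod_congr rfl fun i _ => ?_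
      have := hqm i
      have hqi : q i + 1 + i = (f (Fin.castAdd n i) : ℕ) + i + 2 := by rw [hfl]; omega
      rw [hqi, pow_add _ _ 2]
      simp [σ]
    · have := hq hij; have := hqm i
      change (f _ : ℕ) < f _
      rw [hfl, hfl]; omega
    · have := hp hij; have := hpm i
      change (f _ : ℕ) < f _
      rw [hfr, hfr]; omega
  have happ : Fin.append (fun k => eb (m + n) (q k)) (fun k => eb (m + n) (p k)) =
      (fun k : Fin (m + n) => eb (m + n) ((k : ℕ) + 1)) ∘ σ := by
    funext k
    induction k using Fin.addCases with
    | left k =>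
      have := hqm k
      have hk : (σ (Fin.castAdd n k) : ℕ) + 1 = q k := by
        change (f _ : ℕ) + 1 = _
        rw [hfl]; omega
      simp [hk]
    | right k =>
      have := hpm k
      have hk : (σ (Fin.natAdd m k) : ℕ) + 1 = p k := by
        change (f _ : ℕ) + 1 = _
        rw [hfr]; omega
      simp [hk]
  rw [ExteriorAlgebra.ιMulti_mul_ιMulti, happ, AlternatingMap.map_perm, hσ, topWedge,
    Units.smul_def, ← Int.cast_smul_eq_zsmul ℂ]
  congr 1
  push_cast
  rfl

/-- The Hodge star property: for partitions `Q, P` in the `a × a` square,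
`x_Q ∧ x_P = det (B(e_{qᵢ}, e_{rⱼ}))_{ij} ⬝ e₁ ∧ ⋯ ∧ e_{2a}`, where `q` enumerates
`S(Q)` increasingly and `r` enumerates `S(τ(P))` increasingly. -/
theorem wedge_mul_eq_det_Bform (a : ℕ) (lamQ lamP : Fin a → ℕ)
    (hQ : IsRect a a lamQ) (hP : IsRect a a lamP) :
    xWedge (2 * a) a lamQ * xWedge (2 * a) a lamP =
      (Matrix.of fun i j : Fin a =>
          Bform a (sInc a lamQ i) (sInc a (seqTau a a lamP) j)).det •
        topWedge (2 * a) := by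
  have hT : IsRect a a (seqTau a a lamP) := IsRect.seqTau lamP
  let C : Finset ℕ := Icc 1 (a + a) \ univ.image (sInc a lamP)
  have hsub : univ.image (sInc a lamP) ⊆ Icc 1 (a + a) :=
    image_subset_iff.2 fun i _ => sInc_mem_Icc hP i
  have hC : C.card = a := by
    rw [card_sdiff_of_subset hsub, card_image_of_injective _ (sInc_strictMono hP.1).injective]
    simp
  let r : Fin a → ℕ := fun i => a + a + 1 - sInc a (seqTau a a lamP) i.rev
  have hTm (i : Fin a) := mem_Icc.1 (sInc_mem_Icc hT i)
  have hrmono : StrictMono r := fun i j hij => by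
    have := sInc_strictMono hT.1 (Fin.rev_lt_rev.2 hij)
    have := hTm i.rev
    simp only [r]
    omega
  have hrC (i : Fin a) : r i ∈ C := by
    have hi := hTm i.rev
    simp only [C, r, mem_sdiff, mem_Icc, mem_image, mem_univ, true_and, not_exists]
    refine ⟨by omega, fun k hk => sInc_add_sInc_seqTau_ne hP.1 k i.rev ?_⟩
    omega
  by_cases hdisj : ∀ i j, sInc a lamQ i ≠ sInc a lamP j
  · have hQC (i : Fin a) : sInc a lamQ i ∈ C := by
      simp only [C, mem_sdiff, mem_image, mem_univ, true_and, not_exists]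
      exact ⟨sInc_mem_Icc hQ i, fun k hk => hdisj i k hk.symm⟩
    have hQr : sInc a lamQ = r := (orderEmbOfFin_unique hC hQC (sInc_strictMono hQ.1)).trans
      (orderEmbOfFin_unique hC hrC hrmono).symm
    rw [det_Bform_of_add_eq (sInc_strictMono hQ.1).injective fun i => ?_, two_mul]
    · exact ιMulti_eb_mul_ιMulti_eb (sInc_strictMono hQ.1) (sInc_strictMono hP.1)
        (sInc_mem_Icc hQ) (sInc_mem_Icc hP) hdisj
    · have := hTm i.rev
      simp only [hQr, r]
      omega
  · push Not at hdisj
    obtain ⟨i, j, hij⟩ := hdisj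
    rw [Matrix.det_eq_zero_of_row_eq_zero i fun k => ?_, zero_smul, xWedge, xWedge,
      ExteriorAlgebra.ιMulti_mul_ιMulti]
    · refine AlternatingMap.map_eq_zero_of_eq (i := Fin.castAdd a i) (j := Fin.natAdd a j) _ _ ?_ ?_
      · rw [Fin.append_left, Fin.append_right, hij]
      · have := i.isLt
        simp only [ne_eq, Fin.ext_iff, Fin.val_castAdd, Fin.val_natAdd]
        omega
    · simp only [Matrix.of_apply, Bform]
      refine if_neg fun hk => sInc_add_sInc_seqTau_ne hP.1 j k ?_
      omega
end
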